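/- On the probability space ((0,1), Borel σ-algebra, Lebesgue measure), let q : (0,1) → ℝ be nondecreasing and Lebesgue-integrable with ∫_0^1 max(q(s),0)·log⁺(q(s)) ds = ∞, and define the process X_t(s) = H(t) for t ≤ s and X_t(s) = q(s) for t > s, for t ∈ [0,1] and s ∈ (0,1), where H(t) = (1/(1−t)) ∫_t^1 q(u) du. Then the supremum of the process is not integrable: ∫_0^1 sup_{t∈[0,1]} X_t(s) ds = ∞. -/

import Mathlib

open MeasureTheory Filter Set
open scoped ENNReal

/-- The kernel `1 / (1 - s)` integrates over `(a, b)` to `log (1 - a) - log (1 - b)`. -/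
lemma lintegral_Ioo_inv_one_sub {a b : ℝ} (hab : a ≤ b) (hb : b < 1) :
    ∫⁻ s in Ioo a b, ENNReal.ofReal (1 - s)⁻¹
      = ENNReal.ofReal (Real.log (1 - a) - Real.log (1 - b)) := by
  have hcont : ContinuousOn (fun s : ℝ => (1 - s)⁻¹) (uIcc a b) := by
    refine ContinuousOn.inv₀ (by fun_prop) fun s hs => ?_
    rw [uIcc_of_le hab] at hs
    linarith [hs.2]
  have hFTC : ∫ s in a..b, (1 - s)⁻¹ = Real.log (1 - a) - Real.log (1 - b) := by
    rw [intervalIntegral.integral_eq_sub_of_hasDerivAt (f := fun s => -Real.log (1 - s)) _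
      hcont.intervalIntegrable]
    · ring
    · intro s hs
      rw [uIcc_of_le hab] at hs
      have hne : 1 - s ≠ 0 := by linarith [hs.2]
      have h := (((hasDerivAt_id' s).const_sub 1).log hne).neg
      rwa [neg_div, neg_neg, one_div] at h
  rw [← hFTC, intervalIntegral.integral_of_le hab,
    restrict_Ioo_eq_restrict_Ioc]
  refine (ofReal_integral_eq_lintegral_ofReal ?_ ?_).symm
  · exact (intervalIntegrable_iff_integrableOn_Ioc_of_le hab).1 hcont.intervalIntegrable
  · filter_upwards [ae_restrict_mem measurableSet_Ioc] with s hs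
    exact inv_nonneg.2 (by linarith [hs.2])

/-- Tonelli's theorem for the tail averages of a nonnegative function on `(a, 1)`. -/
lemma lintegral_Ioo_inv_one_sub_mul_tail {a : ℝ} {f : ℝ → ℝ≥0∞}
    (hf : AEMeasurable f (volume.restrict (Ioo a 1))) :
    ∫⁻ s in Ioo a 1, ENNReal.ofReal (1 - s)⁻¹ * ∫⁻ u in Ioo s 1, f u
      = ∫⁻ u in Ioo a 1, ENNReal.ofReal (Real.log (1 - a) - Real.log (1 - u)) * f u := by
  have hswap := lintegral_lintegral_swap (μ := volume.restrict (Ioo a 1))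
    (ν := volume.restrict (Ioo a 1))
    (f := fun s u => {p : ℝ × ℝ | p.1 < p.2}.indicator
      (fun p => ENNReal.ofReal (1 - p.1)⁻¹) (s, u) * f u) (by
        refine AEMeasurable.mul (Measurable.aemeasurable ?_) hf.comp_snd
        exact Measurable.indicator (by fun_prop) (measurableSet_lt measurable_fst measurable_snd))
  calc _ = _ := setLIntegral_congr_fun measurableSet_Ioo fun s hs => ?_
    _ = _ := hswap
    _ = _ := setLIntegral_congr_fun measurableSet_Ioo fun u hu => ?_
  · have hsub : Ioo s 1 = Ioi s ∩ Ioo a 1 := by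
      ext u
      exact ⟨fun h => ⟨h.1, hs.1.trans h.1, h.2⟩, fun h => ⟨h.1, h.2.2⟩⟩
    rw [hsub, ← Measure.restrict_restrict measurableSet_Ioi,
      ← lintegral_const_mul' _ _ ENNReal.ofReal_ne_top, ← lintegral_indicator measurableSet_Ioi]
    refine lintegral_congr fun u => ?_
    by_cases h : s < u <;> simp [indicator, h]
  · have hsub : Ioo a u = Iio u ∩ Ioo a 1 := by
      ext s
      exact ⟨fun h => ⟨h.2, h.1, h.2.trans hu.2⟩, fun h => ⟨h.2.1, h.1⟩⟩
    rw [← lintegral_Ioo_inv_one_sub hu.1.le hu.2, hsub,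
      ← Measure.restrict_restrict measurableSet_Iio, ← lintegral_indicator measurableSet_Iio,
      ← lintegral_mul_const]
    · refine lintegral_congr fun s => ?_
      by_cases h : s < u <;> simp [indicator, h]
    · have hmeas : Measurable fun p : ℝ × ℝ => ENNReal.ofReal (1 - p.1)⁻¹ := by fun_prop
      exact (hmeas.indicator (measurableSet_lt measurable_fst measurable_snd)).comp
        (measurable_id.prodMk measurable_const)

/-- A nondecreasing function that is not in `L log L` on `(0, 1)` exceeds `1` somewhere, and is
already not in `L log L` to the right of such a point. -/
lemma exists_one_lt_and_lintegral_Ioo_mul_log_eq_top {q : ℝ → ℝ} (hq : MonotoneOn q (Ioo 0 1))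
    (h : ∫⁻ s in Ioo (0 : ℝ) 1,
      ENNReal.ofReal (max (q s) 0 * max (Real.log (q s)) 0) = ⊤) :
    ∃ a ∈ Ioo (0 : ℝ) 1, 1 < q a ∧
      ∫⁻ s in Ioo a 1, ENNReal.ofReal (q s * Real.log (q s)) = ⊤ := by
  have hbdd : ∀ (S : Set ℝ) (c : ℝ), S ⊆ Ioo 0 1 → MeasurableSet S → 1 ≤ c → (∀ s ∈ S, q s ≤ c) →
      ∫⁻ s in S, ENNReal.ofReal (max (q s) 0 * max (Real.log (q s)) 0) ≠ ⊤ := by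
    intro S c hS hSm hc hle
    have hSfin : volume S < ⊤ := (measure_mono hS).trans_lt measure_Ioo_lt_top
    refine ((setLIntegral_mono measurable_const (g := fun _ => ENNReal.ofReal (c * Real.log c))
      fun s hs => ENNReal.ofReal_le_ofReal ?_).trans_lt ?_).ne
    · rcases le_or_gt (q s) 0 with h0 | h0
      · rw [max_eq_right h0, zero_mul]
        exact mul_nonneg (by linarith) (Real.log_nonneg hc)
      · exact mul_le_mul (max_le (hle s hs) (by linarith))
          (max_le (Real.log_le_log h0 (hle s hs)) (Real.log_nonneg hc)) (le_max_right _ _)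
          (by linarith)
    · rw [setLIntegral_const]
      exact ENNReal.mul_lt_top ENNReal.ofReal_lt_top hSfin
  obtain ⟨a, ha, hqa⟩ : ∃ a ∈ Ioo (0 : ℝ) 1, 1 < q a := by
    by_contra! hcon
    exact hbdd _ 1 subset_rfl measurableSet_Ioo le_rfl hcon h
  refine ⟨a, ha, hqa, ?_⟩
  rw [← Ioc_union_Ioo_eq_Ioo ha.1.le ha.2, lintegral_union measurableSet_Ioo
    (Set.disjoint_left.2 fun s h₁ h₂ => not_lt.2 h₁.2 h₂.1)] at h
  have hsub : Ioc 0 a ⊆ Ioo (0 : ℝ) 1 := fun s hs => ⟨hs.1, hs.2.trans_lt ha.2⟩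
  rw [← (ENNReal.add_eq_top.1 h).resolve_left (hbdd _ (q a) hsub measurableSet_Ioc hqa.le
    fun s hs => hq (hsub hs) ha hs.2)]
  refine setLIntegral_congr_fun measurableSet_Ioo fun s hs => ?_
  have hqs : 1 ≤ q s := hqa.le.trans (hq ha ⟨ha.1.trans hs.1, hs.2⟩ hs.1.le)
  rw [max_eq_left (by linarith), max_eq_left (Real.log_nonneg hqs)]

/-- The integral of the Hardy–Littlewood maximal function of a nondecreasing integrable function
outside `L log L` diverges. -/
lemma lintegral_tail_average_eq_top {q : ℝ → ℝ} (hq_mono : MonotoneOn q (Ioo 0 1))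
    (hq_int : IntegrableOn q (Ioo 0 1))
    (hLlogL : ∫⁻ s in Ioo (0 : ℝ) 1,
      ENNReal.ofReal (max (q s) 0 * max (Real.log (q s)) 0) = ⊤) :
    ∫⁻ s in Ioo (0 : ℝ) 1, ENNReal.ofReal ((1 - s)⁻¹ * ∫ u in Ioo s 1, q u) = ⊤ := by
  obtain ⟨a, ha, hqa, htop⟩ := exists_one_lt_and_lintegral_Ioo_mul_log_eq_top hq_mono hLlogL
  have hsub : Ioo a 1 ⊆ Ioo 0 1 := Ioo_subset_Ioo_left ha.1.le
  have hqI : IntegrableOn q (Ioo a 1) := hq_int.mono_set hsub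
  have hq1 : ∀ s ∈ Ioo a 1, 1 < q s := fun s hs =>
    hqa.trans_le (hq_mono ha (hsub hs) hs.1.le)
  set C := ∫ u in Ioo a 1, q u
  have hC : ∀ u ∈ Ioo a 1, (1 - u) * q u ≤ C := fun u hu => by
    have hsub' : Ioo u 1 ⊆ Ioo a 1 := Ioo_subset_Ioo_left hu.1.le
    calc (1 - u) * q u = ∫ _ in Ioo u 1, q u := by simp [hu.2.le]
      _ ≤ ∫ v in Ioo u 1, q v :=
        setIntegral_mono_on (by simp) (hqI.mono_set hsub') measurableSet_Ioo
          fun v hv => hq_mono (hsub hu) (hsub (hsub' hv)) hv.1.le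
      _ ≤ C := setIntegral_mono_set hqI
        ((ae_restrict_mem measurableSet_Ioo).mono fun v hv => zero_le_one.trans (hq1 v hv).le)
        hsub'.eventuallyLE
  set c := |Real.log C - Real.log (1 - a)|
  have hle : ∀ u ∈ Ioo a 1, ENNReal.ofReal (q u * Real.log (q u)) ≤
      ENNReal.ofReal c * ENNReal.ofReal (q u) +
        ENNReal.ofReal (Real.log (1 - a) - Real.log (1 - u)) * ENNReal.ofReal (q u) := by
    intro u hu
    have h1 := hq1 u hu
    have hu1 : 0 < 1 - u := by linarith [hu.2]
    have hlog : Real.log (1 - u) ≤ Real.log (1 - a) := Real.log_le_log hu1 (by linarith [hu.1])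
    have hlogC := Real.log_le_log (mul_pos hu1 (by linarith)) (hC u hu)
    rw [Real.log_mul hu1.ne' (by linarith)] at hlogC
    rw [← add_mul, ← ENNReal.ofReal_add (abs_nonneg _) (by linarith),
      ← ENNReal.ofReal_mul (add_nonneg (abs_nonneg _) (by linarith)), mul_comm]
    refine ENNReal.ofReal_le_ofReal (mul_le_mul_of_nonneg_right ?_ (by linarith))
    linarith [le_abs_self (Real.log C - Real.log (1 - a))]
  have hfin : ∫⁻ u in Ioo a 1, ENNReal.ofReal c * ENNReal.ofReal (q u) ≠ ⊤ := by
    rw [lintegral_const_mul' _ _ ENNReal.ofReal_ne_top]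
    exact ENNReal.mul_ne_top ENNReal.ofReal_ne_top hqI.lintegral_lt_top.ne
  have hqm : AEMeasurable (fun u => ENNReal.ofReal (q u)) (volume.restrict (Ioo a 1)) :=
    hqI.aemeasurable.ennreal_ofReal
  have hsum := htop.symm.le.trans (setLIntegral_mono' measurableSet_Ioo hle)
  rw [lintegral_add_left' (hqm.const_mul _), top_le_iff] at hsum
  have htail := (ENNReal.add_eq_top.1 hsum).resolve_left hfin
  rw [← lintegral_Ioo_inv_one_sub_mul_tail hqm] at htail
  rw [← top_le_iff, ← htail]
  refine le_trans (setLIntegral_mono' measurableSet_Ioo fun s hs => ?_) (lintegral_mono_set hsub)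
  have hsub' : Ioo s 1 ⊆ Ioo a 1 := Ioo_subset_Ioo_left hs.1.le
  rw [ENNReal.ofReal_mul (inv_nonneg.2 (by linarith [hs.2])),
    ofReal_integral_eq_lintegral_ofReal (hqI.mono_set hsub')
      ((ae_restrict_mem measurableSet_Ioo).mono fun v hv =>
        zero_le_one.trans (hq1 v (hsub' hv)).le)]

/-- **The Dubins–Gilat martingale has non-integrable supremum.**  Let `q` be
nondecreasing and Lebesgue-integrable on `(0,1)` with
`∫_0^1 max(q(s),0) log⁺(q(s)) ds = ∞`, let `H(t) = (1/(1−t)) ∫_t^1 q(u) du`, and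
let `X_t(s) = H(t)` for `t ≤ s`, `X_t(s) = q(s)` for `t > s`.  Then
`∫_0^1 sup_{t∈[0,1]} X_t(s) ds = ∞`. -/
theorem dubinsGilat_process_sup_not_integrable
    (q : ℝ → ℝ) (hq_mono : MonotoneOn q (Ioo 0 1))
    (hq_int : IntegrableOn q (Ioo 0 1))
    (hLlogL : ∫⁻ s in Ioo (0 : ℝ) 1,
        ENNReal.ofReal (max (q s) 0 * max (Real.log (q s)) 0) = ⊤)
    (H : ℝ → ℝ) (hH : ∀ t, H t = (1 - t)⁻¹ * ∫ u in Ioo t 1, q u)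
    (X : ℝ → ℝ → ℝ)
    (hX : ∀ t s, X t s = if t ≤ s then H t else q s) :
    ∫⁻ s in Ioo (0 : ℝ) 1,
        ENNReal.ofReal (⨆ t : Icc (0 : ℝ) 1, X t s) = ⊤ := by
  rw [← top_le_iff, ← lintegral_tail_average_eq_top hq_mono hq_int hLlogL]
  refine setLIntegral_mono' measurableSet_Ioo fun s hs => ENNReal.ofReal_le_ofReal ?_
  have hbdd : BddAbove (range fun t : Icc (0 : ℝ) 1 => X t s) := by
    refine ⟨max ((1 - s)⁻¹ * ∫ u in Ioo (0 : ℝ) 1, |q u|) (q s), ?_⟩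
    rintro _ ⟨⟨t, ht⟩, rfl⟩
    dsimp only
    rw [hX]
    split_ifs with hts
    · refine le_max_of_le_left ?_
      have hsub : Ioo t 1 ⊆ Ioo 0 1 := Ioo_subset_Ioo_left ht.1
      have hs1 : 0 < 1 - s := by linarith [hs.2]
      rw [hH]
      calc (1 - t)⁻¹ * ∫ u in Ioo t 1, q u ≤ (1 - t)⁻¹ * ∫ u in Ioo t 1, |q u| :=
            mul_le_mul_of_nonneg_left
              (integral_mono (hq_int.mono_set hsub) (hq_int.mono_set hsub).abs
                fun u => le_abs_self _)
              (inv_nonneg.2 (by linarith))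
        _ ≤ (1 - s)⁻¹ * ∫ u in Ioo (0 : ℝ) 1, |q u| :=
            mul_le_mul (inv_anti₀ hs1 (by linarith))
              (setIntegral_mono_set hq_int.abs (ae_of_all _ fun u => abs_nonneg _)
                hsub.eventuallyLE)
              (integral_nonneg fun u => abs_nonneg _) (inv_nonneg.2 hs1.le)
    · exact le_max_right _ _
  refine le_trans (le_of_eq ?_) (le_ciSup hbdd ⟨s, hs.1.le, hs.2.le⟩)
  simp [hX, hH]
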